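/- Let f be a continuous function on [0,1] and α = (α₁,…,αₙ) a multi-index of positive real numbers. Then ∫_{r₁²+⋯+rₙ²<1, rᵢ>0} f(r₁²+⋯+rₙ²) r₁^{2α₁-1}⋯rₙ^{2αₙ-1} dr = (1/2ⁿ) (∏ᵢ Γ(αᵢ)/Γ(|α|)) ∫₀¹ f(τ) τ^{|α|-1} dτ. -/

import Mathlib

open MeasureTheory Real

/-- The Riemann–Liouville kernel `t ^ (a - 1) / Γ(a)` on the positive half-line, extended by zero. -/
noncomputable def rieszKernel (a t : ℝ) : ℝ :=
  if 0 < t then t ^ (a - 1) / Gamma a else 0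

/-- The density `2 r ^ (2 a - 1) / Γ(a)` on the positive half-line, extended by zero: it is carried
by squaring to `rieszKernel a`. -/
noncomputable def sqRieszKernel (a r : ℝ) : ℝ :=
  if 0 < r then 2 * r ^ (2 * a - 1) / Gamma a else 0

/-- The measure on `ℝ` with density `rieszKernel a`. -/
noncomputable def rieszMeasure (a : ℝ) : Measure ℝ :=
  volume.withDensity fun t ↦ ENNReal.ofReal (rieszKernel a t)

/-- The measure on `ℝ` with density `sqRieszKernel a`. -/
noncomputable def sqRieszMeasure (a : ℝ) : Measure ℝ :=
  volume.withDensity fun r ↦ ENNReal.ofReal (sqRieszKernel a r)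

instance (a : ℝ) : SigmaFinite (rieszMeasure a) := by
  unfold rieszMeasure; infer_instance

instance (a : ℝ) : SigmaFinite (sqRieszMeasure a) := by
  unfold sqRieszMeasure; infer_instance

@[fun_prop]
lemma measurable_rieszKernel (a : ℝ) : Measurable (rieszKernel a) :=
  Measurable.ite measurableSet_Ioi (by fun_prop) (by fun_prop)

@[fun_prop]
lemma measurable_sqRieszKernel (a : ℝ) : Measurable (sqRieszKernel a) :=
  Measurable.ite measurableSet_Ioi (by fun_prop) (by fun_prop)

lemma rieszKernel_nonneg {a : ℝ} (ha : 0 < a) (t : ℝ) : 0 ≤ rieszKernel a t := by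
  have := Gamma_pos_of_pos ha
  unfold rieszKernel
  split_ifs <;> positivity

lemma sqRieszKernel_nonneg {a : ℝ} (ha : 0 < a) (r : ℝ) : 0 ≤ sqRieszKernel a r := by
  have := Gamma_pos_of_pos ha
  unfold sqRieszKernel
  split_ifs <;> positivity

lemma rieszKernel_mul_rieszKernel_sub {a b z : ℝ} (ha : 0 < a) (hb : 0 < b) (hz : 0 < z) (u : ℝ) :
    z * (rieszKernel a (z * u) * rieszKernel b (-(z * u) + z)) =
      rieszKernel (a + b) z * ProbabilityTheory.betaPDFReal a b u := by
  have hΓa := (Gamma_pos_of_pos ha).ne'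
  have hΓb := (Gamma_pos_of_pos hb).ne'
  have hΓab := (Gamma_pos_of_pos (add_pos ha hb)).ne'
  have hzu : -(z * u) + z = z * (1 - u) := by ring
  rw [hzu, ProbabilityTheory.betaPDFReal]
  simp only [rieszKernel, mul_pos_iff_of_pos_left hz, sub_pos, hz, if_true]
  by_cases h0 : 0 < u
  · by_cases h1 : u < 1
    · rw [if_pos h0, if_pos h1, if_pos ⟨h0, h1⟩, mul_rpow hz.le h0.le,
        mul_rpow hz.le (sub_pos.2 h1).le, ProbabilityTheory.beta,
        show a + b - 1 = (a - 1) + (b - 1) + 1 by ring, rpow_add hz, rpow_add hz, rpow_one]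
      field_simp
    · simp [h1]
  · simp [h0]

lemma lconvolution_rieszKernel {a b : ℝ} (ha : 0 < a) (hb : 0 < b) :
    lconvolution (fun t ↦ ENNReal.ofReal (rieszKernel a t))
      (fun t ↦ ENNReal.ofReal (rieszKernel b t)) volume =
      fun t ↦ ENNReal.ofReal (rieszKernel (a + b) t) := by
  ext z
  rw [lconvolution_def]
  simp_rw [← ENNReal.ofReal_mul (rieszKernel_nonneg ha _)]
  rcases le_or_gt z 0 with hz | hz
  · rw [lintegral_eq_zero_of_ae_eq_zero, rieszKernel, if_neg hz.not_gt, ENNReal.ofReal_zero]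
    refine .of_forall fun x ↦ ?_
    by_cases hx : 0 < x
    · have : ¬ 0 < -x + z := by linarith
      simp [rieszKernel, this]
    · simp [rieszKernel, hx]
  · rw [← Real.smul_map_volume_mul_left hz.ne', lintegral_smul_measure,
      lintegral_map (by fun_prop) (by fun_prop), abs_of_pos hz, smul_eq_mul,
      ← lintegral_const_mul _ (by fun_prop)]
    simp_rw [← ENNReal.ofReal_mul hz.le, rieszKernel_mul_rieszKernel_sub ha hb hz,
      ENNReal.ofReal_mul (rieszKernel_nonneg (add_pos ha hb) z)]
    rw [lintegral_const_mul _ (by fun_prop)]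
    have := ProbabilityTheory.lintegral_betaPDF_eq_one ha hb
    simp only [ProbabilityTheory.betaPDF] at this
    rw [this, mul_one]

lemma rieszMeasure_conv_rieszMeasure {a b : ℝ} (ha : 0 < a) (hb : 0 < b) :
    (rieszMeasure a).conv (rieszMeasure b) = rieszMeasure (a + b) := by
  rw [rieszMeasure, rieszMeasure, conv_withDensity_eq_lconvolution (by fun_prop) (by fun_prop),
    lconvolution_rieszKernel ha hb, rieszMeasure]

lemma map_sq_sqRieszMeasure (a : ℝ) :
    (sqRieszMeasure a).map (fun r ↦ r ^ 2) = rieszMeasure a := by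
  refine Measure.ext_of_lintegral _ fun g hg ↦ ?_
  have hsq : ((fun r ↦ ENNReal.ofReal (sqRieszKernel a r)) * fun r ↦ g (r ^ 2)).support ⊆
      Set.Ioi 0 := fun t ht ↦ by
    by_contra h
    exact ht (by simp [sqRieszKernel, show ¬ 0 < t from h])
  have hriesz : ((fun t ↦ ENNReal.ofReal (rieszKernel a t)) * g).support ⊆ Set.Ioi 0 :=
    fun t ht ↦ by
      by_contra h
      exact ht (by simp [rieszKernel, show ¬ 0 < t from h])
  rw [lintegral_map hg (by fun_prop), sqRieszMeasure, rieszMeasure,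
    lintegral_withDensity_eq_lintegral_mul _ (by fun_prop) (by fun_prop),
    lintegral_withDensity_eq_lintegral_mul _ (by fun_prop) hg,
    ← setLIntegral_eq_of_support_subset (s := Set.Ioi 0) hsq,
    ← setLIntegral_eq_of_support_subset (s := Set.Ioi 0) hriesz]
  · have himage : (fun r : ℝ ↦ r ^ 2) '' Set.Ioi 0 = Set.Ioi 0 := by
      ext t
      refine ⟨?_, fun ht ↦ ⟨√t, sqrt_pos.2 ht, sq_sqrt (le_of_lt ht)⟩⟩
      rintro ⟨r, hr, rfl⟩
      exact pow_pos (Set.mem_Ioi.1 hr) 2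
    have hinj : Set.InjOn (fun r : ℝ ↦ r ^ 2) (Set.Ioi 0) := fun x hx y hy h ↦
      (pow_left_inj₀ (le_of_lt hx) (le_of_lt hy) two_ne_zero).1 h
    conv_rhs => rw [← himage]
    rw [lintegral_image_eq_lintegral_abs_deriv_mul measurableSet_Ioi
      (fun x _ ↦ (hasDerivAt_pow 2 x).hasDerivWithinAt) hinj]
    refine setLIntegral_congr_fun measurableSet_Ioi fun r hr ↦ ?_
    have hr : 0 < r := hr
    have h2r : 0 ≤ 2 * r := by positivity
    simp only [Pi.mul_apply, Nat.cast_ofNat, Nat.add_one_sub_one, pow_one, abs_of_nonneg h2r]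
    rw [← mul_assoc, ← ENNReal.ofReal_mul h2r]
    congr 2
    rw [sqRieszKernel, rieszKernel, if_pos hr, if_pos (by positivity), ← rpow_natCast r 2,
      ← rpow_mul hr.le, show 2 * a - 1 = ((2 : ℕ) : ℝ) * (a - 1) + 1 by push_cast; ring,
      rpow_add hr, rpow_one]
    ring

lemma map_sum_pi_rieszMeasure (n : ℕ) {α : Fin (n + 1) → ℝ} (hα : ∀ i, 0 < α i) :
    (Measure.pi fun i ↦ rieszMeasure (α i)).map (fun t ↦ ∑ i, t i) = rieszMeasure (∑ i, α i) := by
  induction n with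
  | zero =>
    simpa using (measurePreserving_piUnique fun i : Fin 1 ↦ rieszMeasure (α i)).map_eq
  | succ n ih =>
    have hsum : 0 < ∑ i : Fin (n + 1), α i.succ :=
      Finset.sum_pos (fun i _ ↦ hα _) Finset.univ_nonempty
    rw [Fin.sum_univ_succ α, ← rieszMeasure_conv_rieszMeasure (hα 0) hsum,
      ← ih fun i ↦ hα i.succ]
    refine Measure.ext_of_lintegral _ fun g hg ↦ ?_
    rw [Measure.lintegral_conv hg, lintegral_map hg (by fun_prop),
      ← (measurePreserving_piFinSuccAbove (fun i ↦ rieszMeasure (α i)) 0).symm.lintegral_comp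
        (by fun_prop), lintegral_prod _ (by fun_prop)]
    refine lintegral_congr fun x ↦ ?_
    rw [lintegral_map (by fun_prop) (by fun_prop)]
    simp [Fin.sum_univ_succ]

lemma map_sum_sq_pi_sqRieszMeasure (n : ℕ) {α : Fin (n + 1) → ℝ} (hα : ∀ i, 0 < α i) :
    (Measure.pi fun i ↦ sqRieszMeasure (α i)).map (fun r ↦ ∑ i, r i ^ 2) =
      rieszMeasure (∑ i, α i) := by
  have (i : Fin (n + 1)) : SigmaFinite ((sqRieszMeasure (α i)).map fun r ↦ r ^ 2) := by
    rw [map_sq_sqRieszMeasure]; infer_instance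
  have hpi := Measure.pi_map_pi (μ := fun i ↦ sqRieszMeasure (α i))
    (f := fun _ r ↦ r ^ 2) (fun i ↦ by fun_prop)
  simp_rw [map_sq_sqRieszMeasure] at hpi
  rw [← map_sum_pi_rieszMeasure n hα, ← hpi, Measure.map_map (by fun_prop) (by fun_prop)]
  rfl

lemma lintegral_pi_prod_eq_prod (n : ℕ) {μ : Fin n → Measure ℝ} [∀ i, SigmaFinite (μ i)]
    {f : Fin n → ℝ → ENNReal} (hf : ∀ i, Measurable (f i)) :
    ∫⁻ x, ∏ i, f i (x i) ∂Measure.pi μ = ∏ i, ∫⁻ x, f i x ∂μ i := by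
  induction n with
  | zero => simp
  | succ n ih =>
    rw [← (measurePreserving_piFinSuccAbove μ 0).symm.lintegral_comp (by fun_prop),
      Fin.prod_univ_succ]
    simp only [MeasurableEquiv.piFinSuccAbove_symm_apply, Fin.insertNthEquiv, Fin.prod_univ_succ,
      Fin.insertNth_zero, Equiv.coe_fn_mk, Fin.cons_succ, Fin.zero_succAbove, Fin.cons_zero,
      cast_eq]
    rw [lintegral_prod_mul (hf 0).aemeasurable
      (g := fun y : Fin n → ℝ ↦ ∏ i : Fin n, f i.succ (y i)) (Finset.measurable_fun_prod _ fun i _ ↦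
        (hf i.succ).comp (measurable_pi_apply i)).aemeasurable, ih fun i ↦ hf i.succ]

lemma pi_withDensity {n : ℕ} {μ : Fin n → Measure ℝ} [∀ i, SigmaFinite (μ i)]
    {f : Fin n → ℝ → ENNReal} [∀ i, SigmaFinite ((μ i).withDensity (f i))]
    (hf : ∀ i, Measurable (f i)) :
    Measure.pi (fun i ↦ (μ i).withDensity (f i)) =
      (Measure.pi μ).withDensity fun x ↦ ∏ i, f i (x i) := by
  refine Measure.pi_eq fun s hs ↦ ?_
  rw [withDensity_apply _ (.univ_pi hs), Measure.restrict_pi_pi, lintegral_pi_prod_eq_prod n hf]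
  simp_rw [withDensity_apply _ (hs _)]

lemma integral_pi_sqRieszMeasure {n : ℕ} {α : Fin n → ℝ} (hα : ∀ i, 0 < α i)
    (g : (Fin n → ℝ) → ℝ) :
    ∫ r, g r ∂(Measure.pi fun i ↦ sqRieszMeasure (α i)) =
      ∫ r, (∏ i, sqRieszKernel (α i) (r i)) * g r := by
  simp only [sqRieszMeasure]
  rw [pi_withDensity (fun i ↦ by fun_prop), integral_withDensity_eq_integral_toReal_smul
    (by fun_prop) (.of_forall fun r ↦ ENNReal.prod_lt_top fun i _ ↦ ENNReal.ofReal_lt_top)]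
  simp [volume_pi, ENNReal.toReal_prod, ENNReal.toReal_ofReal (sqRieszKernel_nonneg (hα _) _)]

lemma integral_rieszMeasure {a : ℝ} (ha : 0 < a) (g : ℝ → ℝ) :
    ∫ t, g t ∂rieszMeasure a = ∫ t, rieszKernel a t * g t := by
  rw [rieszMeasure, integral_withDensity_eq_integral_toReal_smul
    (by fun_prop) (.of_forall fun r ↦ ENNReal.ofReal_lt_top)]
  simp [ENNReal.toReal_ofReal (rieszKernel_nonneg ha _)]

/-- The integral of a function of `∑ i, r i ^ 2` against the product of the kernels
`sqRieszKernel (α i)` reduces to a one-dimensional integral. -/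
lemma integral_prod_sqRieszKernel_mul {n : ℕ} (hn : 0 < n) {α : Fin n → ℝ} (hα : ∀ i, 0 < α i)
    {g : ℝ → ℝ} (hg : StronglyMeasurable g) :
    ∫ r : Fin n → ℝ, (∏ i, sqRieszKernel (α i) (r i)) * g (∑ i, r i ^ 2) =
      ∫ t, rieszKernel (∑ i, α i) t * g t := by
  obtain ⟨n, rfl⟩ := Nat.exists_eq_add_one_of_ne_zero hn.ne'
  have hsum : 0 < ∑ i, α i := Finset.sum_pos (fun i _ ↦ hα i) Finset.univ_nonempty
  rw [← integral_rieszMeasure hsum, ← map_sum_sq_pi_sqRieszMeasure n hα,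
    integral_map (Measurable.aemeasurable (by fun_prop)) hg.aestronglyMeasurable,
    integral_pi_sqRieszMeasure hα]

theorem ball_dirichlet_integral (n : ℕ) (hn : 0 < n)
    (f : ℝ → ℝ) (hf : ContinuousOn f (Set.Icc 0 1))
    (α : Fin n → ℝ) (hα : ∀ i, 0 < α i) :
    ∫ r in {r : Fin n → ℝ | (∀ i, 0 < r i) ∧ ∑ i, (r i)^2 < 1},
        f (∑ i, (r i)^2) * ∏ i, (r i) ^ (2 * α i - 1) =
      (1 / 2 ^ n) * ((∏ i, Real.Gamma (α i)) / Real.Gamma (∑ i, α i)) *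
        ∫ τ in Set.Ioo (0:ℝ) 1, f τ * τ ^ ((∑ i, α i) - 1) := by
  have : Nonempty (Fin n) := ⟨⟨0, hn⟩⟩
  set g : ℝ → ℝ := (Set.Ioo 0 1).indicator f with hg_def
  have hg : StronglyMeasurable g := by
    refine Measurable.stronglyMeasurable ?_
    classical
    rw [hg_def, ← Set.piecewise_eq_indicator]
    exact (hf.mono Set.Ioo_subset_Icc_self).measurable_piecewise continuousOn_const
      measurableSet_Ioo
  have hΓ (i) : Gamma (α i) ≠ 0 := (Gamma_pos_of_pos (hα i)).ne'
  have hS : MeasurableSet {r : Fin n → ℝ | (∀ i, 0 < r i) ∧ ∑ i, (r i)^2 < 1} := by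
    measurability
  rw [← integral_indicator hS, ← integral_indicator measurableSet_Ioo]
  have hleft (r : Fin n → ℝ) :
      {r : Fin n → ℝ | (∀ i, 0 < r i) ∧ ∑ i, (r i)^2 < 1}.indicator
        (fun r ↦ f (∑ i, (r i)^2) * ∏ i, (r i) ^ (2 * α i - 1)) r =
      ((1 / 2 ^ n) * ∏ i, Gamma (α i)) *
        ((∏ i, sqRieszKernel (α i) (r i)) * g (∑ i, r i ^ 2)) := by
    by_cases hr : ∀ i, 0 < r i
    · have hsum : 0 < ∑ i, r i ^ 2 :=
        Finset.sum_pos (fun i _ ↦ pow_pos (hr i) 2) Finset.univ_nonempty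
      have hprod : ∏ i, sqRieszKernel (α i) (r i) =
          2 ^ n * (∏ i, r i ^ (2 * α i - 1)) / ∏ i, Gamma (α i) := by
        simp [sqRieszKernel, hr, Finset.prod_div_distrib, Finset.prod_mul_distrib]
      have hΓprod : ∏ i, Gamma (α i) ≠ 0 := Finset.prod_ne_zero_iff.2 fun i _ ↦ hΓ i
      by_cases h1 : ∑ i, r i ^ 2 < 1
      · rw [Set.indicator_of_mem (show r ∈ {r : Fin n → ℝ | (∀ i, 0 < r i) ∧ ∑ i, (r i)^2 < 1} from
          ⟨hr, h1⟩), hg_def,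
          Set.indicator_of_mem (show _ ∈ Set.Ioo _ _ from ⟨hsum, h1⟩), hprod]
        field_simp
      · simp [hg_def, h1]
    · obtain ⟨i, hi⟩ := not_forall.1 hr
      have hzero : ∏ i, sqRieszKernel (α i) (r i) = 0 :=
        Finset.prod_eq_zero (Finset.mem_univ i) (by simp [sqRieszKernel, hi])
      rw [Set.indicator_of_notMem fun h ↦ hr h.1, hzero, zero_mul, mul_zero]
  have hright (t : ℝ) :
      (Set.Ioo (0 : ℝ) 1).indicator (fun τ ↦ f τ * τ ^ ((∑ i, α i) - 1)) t =
        Gamma (∑ i, α i) * (rieszKernel (∑ i, α i) t * g t) := by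
    have := (Gamma_pos_of_pos (Finset.sum_pos (fun i _ ↦ hα i) Finset.univ_nonempty)).ne'
    by_cases ht : t ∈ Set.Ioo (0 : ℝ) 1
    · rw [hg_def, Set.indicator_of_mem ht, Set.indicator_of_mem ht, rieszKernel, if_pos ht.1]
      field_simp
    · simp [hg_def, ht]
  have := (Gamma_pos_of_pos (Finset.sum_pos (fun i _ ↦ hα i) Finset.univ_nonempty)).ne'
  simp_rw [hleft, hright]
  rw [integral_const_mul, integral_const_mul, integral_prod_sqRieszKernel_mul hn hα hg]
  field_simp
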